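/- arXiv:2104.06016 — 7 statements merged into one kernel-verified Lean document; each statement's English description precedes it below -/
import Mathlib

section
/- Let A be a nonempty standard Borel space and let τ be a sub-probability measure on A (i.e. τ(Set.univ) ≤ 1). Then there exist a probability measure μ on ℝ (with the Borel σ-algebra), a Borel set U ⊆ ℝ, and a measurable map α : ℝ → A such that τ = (μ.restrict U).map α. -/
open MeasureTheory

theorem stmt_1 {A : Type*} [MeasurableSpace A] [StandardBorelSpace A] [Nonempty A]
    (τ : Measure A) (hτ : τ Set.univ ≤ 1) :
    ∃ (μ : Measure ℝ) (U : Set ℝ) (α : ℝ → A),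
      IsProbabilityMeasure μ ∧ MeasurableSet U ∧ Measurable α ∧
      τ = (μ.restrict U).map α := by
  obtain ⟨f, hf⟩ := exists_measurableEmbedding_real A
  obtain ⟨h, hh, hhf⟩ := hf.exists_measurable_extend (measurable_id (α := A))
    (fun _ => inferInstance)
  have hg : Measurable (fun a => Real.exp (f a)) := Real.measurable_exp.comp hf.measurable
  have hα : Measurable (fun x => h (Real.log x)) := hh.comp Real.measurable_log
  refine ⟨τ.map (fun a => Real.exp (f a)) + (1 - τ Set.univ) • Measure.dirac (-1),
    Set.Ioi 0, fun x => h (Real.log x), ⟨?_⟩, measurableSet_Ioi, hα, ?_⟩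
  · simp [Measure.map_apply hg MeasurableSet.univ, add_tsub_cancel_of_le hτ]
  · ext s hs
    have hU : MeasurableSet ((fun x => h (Real.log x)) ⁻¹' s) := hα hs
    have hi : MeasurableSet ((fun x => h (Real.log x)) ⁻¹' s ∩ Set.Ioi 0) :=
      hU.inter measurableSet_Ioi
    have key : (fun a => Real.exp (f a)) ⁻¹' ((fun x => h (Real.log x)) ⁻¹' s ∩ Set.Ioi 0)
        = s := by
      ext a
      have : h (f a) = a := congrFun hhf a
      simp [this, Real.exp_pos]
    rw [Measure.map_apply hα hs, Measure.restrict_apply hU, Measure.add_apply,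
      Measure.map_apply hg hi, key, Measure.smul_apply, Measure.dirac_apply' _ hi,
      Set.indicator_of_notMem]
    · simp
    · rintro ⟨_, h0⟩
      have h1 : (0 : ℝ) < -1 := h0
      linarith
end

section
/- Let A₁, A₂ and B be measurable spaces and let T : Measure A₁ × Measure A₂ → Measure B be a measurable map (for the Giry σ-algebras) that commutes with join separately in each argument on sub-probability measures: for every sub-probability measure μ₂ on A₂ and every measure m on Measure A₁ with m(Set.univ) ≤ 1 concentrated on sub-probability measures, T(m.join, μ₂) = ((m.map (fun ν => T(ν, μ₂)))).join, and symmetrically in the second argument. Then for all sub-probability measures μ₁ on A₁ and μ₂ on A₂, T(μ₁, μ₂) = μ₁.bind (fun x₁ => μ₂.bind (fun x₂ => T(Measure.dirac x₁, Measure.dirac x₂))) = μ₂.bind (fun x₂ => μ₁.bind (fun x₁ => T(Measure.dirac x₁, Measure.dirac x₂))); in particular the two iterated binds agree. -/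
open MeasureTheory

theorem linear_aux {A B : Type*} [MeasurableSpace A] [MeasurableSpace B]
    (F : Measure A → Measure B) (hF : Measurable F)
    (hj : ∀ m : Measure (Measure A), m Set.univ ≤ 1 → (∀ᵐ ν ∂m, ν Set.univ ≤ 1) →
      F m.join = (m.map F).join) (μ : Measure A) (hμ : μ Set.univ ≤ 1) :
    F μ = μ.bind fun x => F (Measure.dirac x) := by
  have hd : Measurable (Measure.dirac : A → Measure A) := Measure.measurable_dirac
  have h := hj (μ.map Measure.dirac)
    (by rw [Measure.map_apply hd MeasurableSet.univ]; simpa using hμ)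
    (by
      rw [ae_map_iff hd.aemeasurable
        (measurableSet_le (Measure.measurable_coe MeasurableSet.univ) measurable_const)]
      exact Filter.Eventually.of_forall fun x => by simp)
  rw [Measure.join_map_dirac, Measure.map_map hF hd] at h
  exact h

theorem stmt_7 {A₁ A₂ B : Type*} [MeasurableSpace A₁] [MeasurableSpace A₂]
    [MeasurableSpace B]
    (T : Measure A₁ × Measure A₂ → Measure B) (hT : Measurable T)
    (hj₁ : ∀ μ₂ : Measure A₂, μ₂ Set.univ ≤ 1 →
      ∀ m : Measure (Measure A₁), m Set.univ ≤ 1 → (∀ᵐ ν ∂m, ν Set.univ ≤ 1) →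
        T (m.join, μ₂) = (m.map fun ν => T (ν, μ₂)).join)
    (hj₂ : ∀ μ₁ : Measure A₁, μ₁ Set.univ ≤ 1 →
      ∀ m : Measure (Measure A₂), m Set.univ ≤ 1 → (∀ᵐ ν ∂m, ν Set.univ ≤ 1) →
        T (μ₁, m.join) = (m.map fun ν => T (μ₁, ν)).join) :
    ∀ (μ₁ : Measure A₁) (μ₂ : Measure A₂), μ₁ Set.univ ≤ 1 → μ₂ Set.univ ≤ 1 →
      T (μ₁, μ₂) =
          μ₁.bind (fun x₁ => μ₂.bind fun x₂ => T (Measure.dirac x₁, Measure.dirac x₂)) ∧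
      T (μ₁, μ₂) =
          μ₂.bind (fun x₂ => μ₁.bind fun x₁ => T (Measure.dirac x₁, Measure.dirac x₂)) := by
  intro μ₁ μ₂ h₁ h₂
  have hl : ∀ ν₂ : Measure A₂, Measurable fun ν => T (ν, ν₂) := fun ν₂ =>
    hT.comp (measurable_id.prodMk measurable_const)
  have hr : ∀ ν₁ : Measure A₁, Measurable fun ν => T (ν₁, ν) := fun ν₁ =>
    hT.comp (measurable_const.prodMk measurable_id)
  constructor
  · rw [linear_aux (fun ν => T (ν, μ₂)) (hl μ₂) (hj₁ μ₂ h₂) μ₁ h₁]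
    congr 1
    funext x
    exact linear_aux (fun ν => T (Measure.dirac x, ν)) (hr _) (hj₂ _ (by simp)) μ₂ h₂
  · rw [linear_aux (fun ν => T (μ₁, ν)) (hr μ₁) (hj₂ μ₁ h₁) μ₂ h₂]
    congr 1
    funext x
    exact linear_aux (fun ν => T (ν, Measure.dirac x)) (hl _) (hj₁ _ (by simp)) μ₁ h₁
end

section
/- Let n be a natural number and let c, d : (Fin n → ℕ) → ℝ≥0∞ be two families of coefficients. Suppose that for every r : Fin n → ℝ with rᵢ > 0 for all i and Σᵢ rᵢ < 1, the sums Σ_{α : Fin n → ℕ} c(α) · ∏ᵢ rᵢ^{α i} and Σ_{α : Fin n → ℕ} d(α) · ∏ᵢ rᵢ^{α i} (computed in [0,∞]) are both at most 1 and are equal. Then c = d. -/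
open scoped ENNReal

theorem aux_le (ε : ℝ≥0∞) (hε : 0 < ε) (A B : ℕ → ℝ≥0∞)
    (h : ∀ x : ℝ≥0∞, 0 < x → x < ε → (∑' k, A k * x ^ k) ≠ ⊤ ∧ (∑' k, B k * x ^ k) ≠ ⊤ ∧
      (∑' k, A k * x ^ k) = ∑' k, B k * x ^ k) : A 0 ≤ B 0 := by
  obtain ⟨y, hy0, hyε⟩ := exists_between hε
  have hytop : y ≠ ⊤ := (hyε.trans_le le_top).ne
  have split : ∀ (C : ℕ → ℝ≥0∞) (x : ℝ≥0∞),
      (∑' k, C k * x ^ k) = C 0 + x * ∑' k, C (k + 1) * x ^ k := by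
    intro C x
    rw [tsum_eq_zero_add' ENNReal.summable, ← ENNReal.tsum_mul_left]
    simp only [pow_zero, mul_one]
    congr 1
    refine tsum_congr fun k => ?_
    ring
  set M := ∑' k, B (k + 1) * y ^ k with hM
  have hMtop : M ≠ ⊤ := by
    intro hc
    have := (h y hy0 hyε).2.1
    rw [split B y, ← hM, hc, ENNReal.mul_top hy0.ne'] at this
    simp at this
  have key : ∀ x : ℝ≥0∞, 0 < x → x < y → A 0 ≤ B 0 + x * M := by
    intro x hx hxy
    have h1 := (h x hx (hxy.trans hyε)).2.2
    rw [split A x, split B x] at h1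
    calc A 0 ≤ A 0 + x * ∑' k, A (k + 1) * x ^ k := le_self_add
      _ = _ := h1
      _ ≤ B 0 + x * M := by
        rw [hM]
        gcongr
  have ht : Filter.Tendsto (fun x : ℝ≥0∞ => B 0 + x * M) (nhdsWithin 0 (Set.Ioi 0))
      (nhds (B 0 + 0 * M)) := by
    refine Filter.Tendsto.mono_left ?_ nhdsWithin_le_nhds
    exact tendsto_const_nhds.add (ENNReal.Tendsto.mul_const Filter.tendsto_id (Or.inr hMtop))
  rw [zero_mul, add_zero] at ht
  refine ge_of_tendsto ht ?_
  filter_upwards [Ioo_mem_nhdsGT hy0] with x hx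
  exact key x hx.1 hx.2

theorem aux_one (ε : ℝ≥0∞) (hε : 0 < ε) (k : ℕ) : ∀ (A B : ℕ → ℝ≥0∞)
    (_ : ∀ x : ℝ≥0∞, 0 < x → x < ε → (∑' k, A k * x ^ k) ≠ ⊤ ∧ (∑' k, B k * x ^ k) ≠ ⊤ ∧
      (∑' k, A k * x ^ k) = ∑' k, B k * x ^ k), A k = B k := by
  have split : ∀ (C : ℕ → ℝ≥0∞) (x : ℝ≥0∞),
      (∑' k, C k * x ^ k) = C 0 + x * ∑' k, C (k + 1) * x ^ k := by
    intro C x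
    rw [tsum_eq_zero_add' ENNReal.summable, ← ENNReal.tsum_mul_left]
    simp only [pow_zero, mul_one]
    congr 1
    refine tsum_congr fun k => ?_
    ring
  have zero : ∀ (A B : ℕ → ℝ≥0∞)
    (_ : ∀ x : ℝ≥0∞, 0 < x → x < ε → (∑' k, A k * x ^ k) ≠ ⊤ ∧ (∑' k, B k * x ^ k) ≠ ⊤ ∧
      (∑' k, A k * x ^ k) = ∑' k, B k * x ^ k), A 0 = B 0 := fun A B h =>
    le_antisymm (aux_le ε hε A B h)
      (aux_le ε hε B A fun x h0 h1 => ⟨(h x h0 h1).2.1, (h x h0 h1).1, (h x h0 h1).2.2.symm⟩)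
  induction k with
  | zero => exact zero
  | succ k ih =>
    intro A B h
    have h00 := zero A B h
    refine ih (fun k => A (k + 1)) (fun k => B (k + 1)) fun x hx hxε => ?_
    have hxtop : x ≠ ⊤ := (hxε.trans_le le_top).ne
    obtain ⟨h1, h2, h3⟩ := h x hx hxε
    rw [split] at h1 h2
    rw [split A, split B] at h3
    rw [ENNReal.add_ne_top] at h1 h2
    rw [h00, ENNReal.add_right_inj h2.1, ENNReal.mul_right_inj hx.ne' hxtop] at h3
    refine ⟨fun hc => h1.2 ?_, fun hc => h2.2 ?_, h3⟩
    · rw [hc, ENNReal.mul_top hx.ne']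
    · rw [hc, ENNReal.mul_top hx.ne']

theorem aux_multi (ε : ℝ≥0∞) (hε : 0 < ε) (n : ℕ) : ∀ (c d : (Fin n → ℕ) → ℝ≥0∞)
    (_ : ∀ r : Fin n → ℝ≥0∞, (∀ i, 0 < r i) → (∀ i, r i < ε) →
      (∑' α : Fin n → ℕ, c α * ∏ i, r i ^ α i) ≠ ⊤ ∧
      (∑' α : Fin n → ℕ, d α * ∏ i, r i ^ α i) ≠ ⊤ ∧
      (∑' α : Fin n → ℕ, c α * ∏ i, r i ^ α i) = ∑' α : Fin n → ℕ, d α * ∏ i, r i ^ α i),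
    c = d := by
  induction n with
  | zero =>
    intro c d h
    have := (h (fun _ => 0) (fun i => i.elim0) (fun i => i.elim0)).2.2
    simp only [Finset.univ_eq_empty, Finset.prod_empty, mul_one, tsum_fintype,
      Fintype.sum_unique] at this
    funext α
    have hα : ∀ β : Fin 0 → ℕ, β = α := fun β => Subsingleton.elim _ _
    have gen : ∀ β γ : Fin 0 → ℕ, c β = d γ → c α = d α := by
      intro β γ hh
      rwa [hα β, hα γ] at hh
    exact gen _ _ this
  | succ n ih =>
    intro c d h
    have split : ∀ (e : (Fin (n + 1) → ℕ) → ℝ≥0∞) (x : ℝ≥0∞) (r : Fin n → ℝ≥0∞),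
        (∑' α : Fin (n + 1) → ℕ, e α * ∏ i, (Fin.cons x r : Fin (n + 1) → ℝ≥0∞) i ^ α i) =
        ∑' k : ℕ, (∑' β : Fin n → ℕ, e (Fin.cons k β) * ∏ i, r i ^ β i) * x ^ k := by
      intro e x r
      rw [← (Fin.consEquiv (fun _ : Fin (n + 1) => ℕ)).tsum_eq, ENNReal.tsum_prod']
      refine tsum_congr fun k => ?_
      rw [← ENNReal.tsum_mul_right]
      refine tsum_congr fun β => ?_
      have hcons : (Fin.consEquiv (fun _ : Fin (n + 1) => ℕ)) (k, β) = Fin.cons k β := rfl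
      simp only [hcons, Fin.prod_univ_succ, Fin.cons_zero, Fin.cons_succ]
      ring
    have hk : ∀ (r : Fin n → ℝ≥0∞), (∀ i, 0 < r i) → (∀ i, r i < ε) → ∀ x, 0 < x → x < ε → _ :=
      fun r h0 h1 x hx0 hx1 => h (Fin.cons x r)
        (fun i => Fin.cases (by simpa using hx0) (by simpa using h0) i)
        (fun i => Fin.cases (by simpa using hx1) (by simpa using h1) i)
    simp only [split] at hk
    have fin : ∀ (C : ℕ → ℝ≥0∞) (x : ℝ≥0∞), 0 < x → (∑' k, C k * x ^ k) ≠ ⊤ →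
        ∀ k, C k ≠ ⊤ := by
      intro C x hx hs k hc
      have := ENNReal.ne_top_of_tsum_ne_top hs k
      rw [hc, ENNReal.top_mul (pow_ne_zero _ hx.ne')] at this
      exact this rfl
    have main : ∀ k : ℕ, (fun β : Fin n → ℕ => c (Fin.cons k β)) = fun β => d (Fin.cons k β) := by
      intro k
      refine ih _ _ fun r h0 h1 => ?_
      obtain ⟨y, hy0, hyε⟩ := exists_between hε
      obtain ⟨f1, f2, -⟩ := hk r h0 h1 y hy0 hyε
      exact ⟨fin _ y hy0 f1 k, fin _ y hy0 f2 k, aux_one ε hε k _ _ (hk r h0 h1)⟩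
    funext α
    have := congrFun (main (α 0)) (Fin.tail α)
    simpa only [Fin.cons_self_tail] using this

theorem stmt_9 (n : ℕ) (c d : (Fin n → ℕ) → ℝ≥0∞)
    (h : ∀ r : Fin n → ℝ, (∀ i, 0 < r i) → (∑ i, r i) < 1 →
      (∑' α : Fin n → ℕ, c α * ∏ i, (ENNReal.ofReal (r i)) ^ α i) ≤ 1 ∧
      (∑' α : Fin n → ℕ, d α * ∏ i, (ENNReal.ofReal (r i)) ^ α i) ≤ 1 ∧
      (∑' α : Fin n → ℕ, c α * ∏ i, (ENNReal.ofReal (r i)) ^ α i) =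
        ∑' α : Fin n → ℕ, d α * ∏ i, (ENNReal.ofReal (r i)) ^ α i) :
    c = d := by
  have hpos : (0 : ℝ) < 1 / (n + 1) := by positivity
  refine aux_multi (ENNReal.ofReal (1 / (n + 1))) (by simpa using hpos) n c d fun r h0 h1 => ?_
  have htop : ∀ i, r i ≠ ⊤ := fun i => ((h1 i).trans_le le_top).ne
  have hsum : ∑ i, (r i).toReal < 1 := by
    calc ∑ i, (r i).toReal ≤ ∑ _i : Fin n, (1 / (n + 1) : ℝ) :=
          Finset.sum_le_sum fun i _ => ENNReal.toReal_le_of_le_ofReal hpos.le (h1 i).le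
      _ < 1 := by
        simp only [Finset.sum_const, Finset.card_univ, Fintype.card_fin, nsmul_eq_mul]
        rw [mul_one_div, div_lt_one (by positivity)]
        linarith
  have := h (fun i => (r i).toReal) (fun i => ENNReal.toReal_pos (h0 i).ne' (htop i)) hsum
  simp only [ENNReal.ofReal_toReal (htop _)] at this
  exact ⟨(this.1.trans_lt ENNReal.one_lt_top).ne, (this.2.1.trans_lt ENNReal.one_lt_top).ne,
    this.2.2⟩
end

section
/- Let A and B be measurable spaces. For each n ∈ ℕ let κₙ and λₙ be sub-probability kernels from the product space (Fin n → A) to B, i.e. measurable maps into Measure B with κₙ(x)(Set.univ) ≤ 1 and λₙ(x)(Set.univ) ≤ 1 for all x. Define F(μ) = Σₙ ((μ^{⊗n}).bind κₙ) and G(μ) = Σₙ ((μ^{⊗n}).bind λₙ) for sub-probability measures μ on A, and assume F(μ)(Set.univ) ≤ 1 and G(μ)(Set.univ) ≤ 1 for every sub-probability μ. If F(μ) = G(μ) for every finitely supported sub-probability measure μ on A, then F(μ) = G(μ) for every sub-probability measure μ on A. -/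
open MeasureTheory
open scoped ENNReal

/-- A finitely supported sub-probability measure: a sub-convex combination of
finitely many Dirac measures. -/
def IsFinitelySupportedSubProb {A : Type*} [MeasurableSpace A] (μ : Measure A) : Prop :=
  ∃ (k : ℕ) (x : Fin k → A) (r : Fin k → ℝ≥0∞), (∑ i, r i) ≤ 1 ∧
    μ = ∑ i, r i • Measure.dirac (x i)

lemma aux_series : ∀ (n : ℕ) (d : ℕ → ℝ), (∀ n, |d n| ≤ 1) →
    (∀ t : ℝ, 0 < t → t < 1 → ∑' n, d n * t ^ n = 0) → d n = 0 := by
  have hs : ∀ (d : ℕ → ℝ), (∀ n, |d n| ≤ 1) → ∀ t : ℝ, 0 < t → t < 1 →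
      Summable (fun n => d n * t ^ n) ∧ |∑' n, d n * t ^ n| ≤ (1 - t)⁻¹ := by
    intro d hd t h0 h1
    have hb : ∀ n, ‖d n * t ^ n‖ ≤ t ^ n := by
      intro n
      rw [norm_mul, Real.norm_eq_abs, Real.norm_eq_abs, abs_of_pos (pow_pos h0 n)]
      exact mul_le_of_le_one_left (pow_pos h0 n).le (hd n)
    have hg := hasSum_geometric_of_lt_one h0.le h1
    exact ⟨Summable.of_norm_bounded hg.summable hb, tsum_of_norm_bounded hg hb⟩
  have key : ∀ (d : ℕ → ℝ), (∀ n, |d n| ≤ 1) →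
      (∀ t : ℝ, 0 < t → t < 1 → ∑' n, d n * t ^ n = 0) →
      ∀ t : ℝ, 0 < t → t < 1 → d 0 = - (t * ∑' n, d (n+1) * t ^ n) := by
    intro d hd h t h0 h1
    have := h t h0 h1
    rw [(hs d hd t h0 h1).1.tsum_eq_zero_add, ] at this
    rw [← tsum_mul_left]
    have e : ∀ n, d (n+1) * t^(n+1) = t * (d (n+1) * t^n) := fun n => by ring
    simp only [e, pow_zero, mul_one] at this
    linarith
  have zero : ∀ (d : ℕ → ℝ), (∀ n, |d n| ≤ 1) →
      (∀ t : ℝ, 0 < t → t < 1 → ∑' n, d n * t ^ n = 0) → d 0 = 0 := by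
    intro d hd h
    by_contra hne
    have hp : 0 < |d 0| := abs_pos.mpr hne
    set t := |d 0| / 4 with ht
    have h0 : 0 < t := by positivity
    have h1 : t < 1/2 := by have := hd 0; linarith
    have k := key d hd h t h0 (by linarith)
    have b := (hs (fun n => d (n+1)) (fun n => hd _) t h0 (by linarith)).2
    have c : (1 - t)⁻¹ ≤ 2 := by
      rw [inv_le_comm₀ (by linarith) (by norm_num)]; linarith
    have : |d 0| ≤ t * 2 := by
      conv_lhs => rw [k]
      rw [abs_neg, abs_mul, abs_of_pos h0]
      exact mul_le_mul_of_nonneg_left (b.trans c) h0.le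
    linarith
  intro n
  induction n with
  | zero => exact zero
  | succ n ih =>
    intro d hd h
    refine ih (fun n => d (n+1)) (fun n => hd _) ?_
    intro t h0 h1
    have k := key d hd h t h0 h1
    rw [zero d hd h] at k
    have : t * ∑' n, d (n+1) * t ^ n = 0 := by linarith
    exact (mul_eq_zero.mp this).resolve_left h0.ne'

lemma aux_series_enn (a b : ℕ → ℝ≥0∞) (ha : ∀ n, a n ≤ 1) (hb : ∀ n, b n ≤ 1)
    (h : ∀ t : ℝ, 0 < t → t < 1 →
      ∑' n, ENNReal.ofReal t ^ n * a n = ∑' n, ENNReal.ofReal t ^ n * b n) (n : ℕ) :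
    a n = b n := by
  have hfin : ∀ (a : ℕ → ℝ≥0∞), (∀ n, a n ≤ 1) → ∀ n, a n ≠ ⊤ :=
    fun a ha n => ((ha n).trans_lt ENNReal.one_lt_top).ne
  have h1 : ∀ (a : ℕ → ℝ≥0∞), (∀ n, a n ≤ 1) → ∀ n, (a n).toReal ≤ 1 := fun a ha n =>
    ENNReal.toReal_le_of_le_ofReal zero_le_one (by simpa using ha n)
  have hsum : ∀ (a : ℕ → ℝ≥0∞), (∀ n, a n ≤ 1) → ∀ t : ℝ, 0 < t → t < 1 →
      Summable (fun n => (a n).toReal * t ^ n) ∧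
      (∑' n, ENNReal.ofReal t ^ n * a n).toReal = ∑' n, (a n).toReal * t ^ n := by
    intro a ha t h0 h1'
    constructor
    · refine Summable.of_nonneg_of_le (fun n => by positivity) (fun n => ?_)
        (summable_geometric_of_lt_one h0.le h1')
      exact mul_le_of_le_one_left (by positivity) (h1 a ha n)
    · rw [ENNReal.tsum_toReal_eq]
      · refine tsum_congr fun n => ?_
        rw [ENNReal.toReal_mul, ENNReal.toReal_pow, ENNReal.toReal_ofReal h0.le, mul_comm]
      · intro n
        exact ENNReal.mul_ne_top (ENNReal.pow_ne_top ENNReal.ofReal_ne_top) (hfin a ha n)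
  have := aux_series n (fun n => (a n).toReal - (b n).toReal) (fun n => by
      have := h1 a ha n
      have := h1 b hb n
      have := (a n).toReal_nonneg
      have := (b n).toReal_nonneg
      rw [abs_le]; constructor <;> linarith) (fun t h0 h1' => by
      have e := h t h0 h1'
      obtain ⟨s1, e1⟩ := hsum a ha t h0 h1'
      obtain ⟨s2, e2⟩ := hsum b hb t h0 h1'
      simp only [sub_mul]
      rw [s1.tsum_sub s2, ← e1, ← e2, e, sub_self])
  exact (ENNReal.toReal_eq_toReal_iff' (hfin a ha n) (hfin b hb n)).mp (sub_eq_zero.mp this)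

lemma aux_pi {A : Type*} [MeasurableSpace A] (m k : ℕ) (x : Fin k → A) (r : Fin k → ℝ≥0∞)
    (hr : ∑ i, r i ≤ 1) :
    Measure.pi (fun _ : Fin m => ∑ i, r i • Measure.dirac (x i)) =
      ∑ i : Fin m → Fin k, (∏ j, r (i j)) • Measure.dirac (x ∘ i) := by
  have : IsFiniteMeasure (∑ i, r i • Measure.dirac (x i)) := ⟨by
    simp only [Measure.coe_finsetSum, Finset.sum_apply, Measure.smul_apply, smul_eq_mul,
      measure_univ, mul_one]
    exact hr.trans_lt ENNReal.one_lt_top⟩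
  refine Measure.pi_eq fun s hs => ?_
  simp only [Measure.coe_finsetSum, Finset.sum_apply, Measure.smul_apply, smul_eq_mul]
  rw [Finset.prod_univ_sum]
  simp only [Fintype.piFinset_univ]
  refine Finset.sum_congr rfl fun i _ => ?_
  rw [Finset.prod_mul_distrib, Measure.dirac_apply' _ (MeasurableSet.univ_pi hs)]
  congr 1
  simp only [Measure.dirac_apply' _ (hs _)]
  classical
  by_cases h : ∀ j, x (i j) ∈ s j
  · rw [Set.indicator_of_mem (by simpa using h)]
    simp [h]
  · rw [Set.indicator_of_notMem (by simpa using h)]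
    push Not at h
    obtain ⟨j, hj⟩ := h
    exact (Finset.prod_eq_zero (Finset.mem_univ j) (Set.indicator_of_notMem hj _)).symm

lemma aux_comb (n : ℕ) (h : (Fin n → Fin n) → ℝ)
    (hP : ∀ S : Finset (Fin n), ∑ i ∈ Fintype.piFinset (fun _ : Fin n => S), h i = 0) :
    ∑ σ : Equiv.Perm (Fin n), h σ = 0 := by
  classical
  have Q : ∀ S : Finset (Fin n), ∑ i : Fin n → Fin n with Finset.univ.image i = S, h i = 0 := by
    intro S
    induction S using Finset.strongInduction with
    | H S ih =>
      have e := hP S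
      rw [← Finset.sum_fiberwise_of_maps_to (t := S.powerset)
        (g := fun i => Finset.univ.image i)] at e
      · rw [Finset.sum_eq_single S] at e
        · rw [← e]
          refine Finset.sum_congr ?_ fun _ _ => rfl
          ext i
          simp only [Finset.mem_filter, Finset.mem_univ, true_and, Fintype.mem_piFinset]
          constructor
          · intro hi
            exact ⟨fun j => hi ▸ Finset.mem_image_of_mem _ (Finset.mem_univ j), hi⟩
          · exact fun hi => hi.2
        · intro T hT hne
          have hTS := Finset.mem_powerset.mp hT
          rw [← ih T (hTS.ssubset_of_ne hne)]
          refine Finset.sum_congr ?_ fun _ _ => rfl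
          ext i
          simp only [Finset.mem_filter, Finset.mem_univ, true_and, Fintype.mem_piFinset]
          constructor
          · exact fun hi => hi.2
          · intro hi
            exact ⟨fun j => hTS (hi ▸ Finset.mem_image_of_mem _ (Finset.mem_univ j)), hi⟩
        · intro hn
          exact absurd (Finset.mem_powerset.mpr (Finset.Subset.refl S)) hn
      · intro i hi
        rw [Fintype.mem_piFinset] at hi
        rw [Finset.mem_powerset]
        intro y hy
        obtain ⟨j, _, rfl⟩ := Finset.mem_image.mp hy
        exact hi j
  rw [← Q Finset.univ]
  refine Finset.sum_bij (fun σ _ => (σ : Fin n → Fin n)) ?_ ?_ ?_ ?_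
  · intro σ _
    simp only [Finset.mem_filter, Finset.mem_univ, true_and]
    exact Finset.image_univ_of_surjective σ.surjective
  · intro a _ b _ hab
    exact DFunLike.coe_injective hab
  · intro i hi
    simp only [Finset.mem_filter, Finset.mem_univ, true_and] at hi
    have hs : Function.Surjective i := by
      intro y
      have : y ∈ Finset.univ.image i := by rw [hi]; exact Finset.mem_univ y
      obtain ⟨j, _, hj⟩ := Finset.mem_image.mp this
      exact ⟨j, hj⟩
    exact ⟨Equiv.ofBijective i (Finite.surjective_iff_bijective.mp hs), Finset.mem_univ _, rfl⟩
  · intros; rfl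

lemma aux_sym {A : Type*} [MeasurableSpace A] (n : ℕ) (μ : Measure A) [IsFiniteMeasure μ]
    (f : (Fin n → A) → ℝ≥0∞) (hf : Measurable f) :
    ∫⁻ x, ∑ σ : Equiv.Perm (Fin n), f (x ∘ σ) ∂(Measure.pi fun _ : Fin n => μ) =
      (Fintype.card (Equiv.Perm (Fin n)) : ℝ≥0∞) * ∫⁻ x, f x ∂(Measure.pi fun _ : Fin n => μ) := by
  have hm : ∀ σ : Equiv.Perm (Fin n), Measurable (fun x : Fin n → A => x ∘ σ) := fun σ =>
    measurable_pi_lambda _ fun j => measurable_pi_apply _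
  rw [lintegral_finsetSum (f := fun (σ : Equiv.Perm (Fin n)) (x : Fin n → A) => f (x ∘ σ)) _
    (fun σ _ => hf.comp (hm σ))]
  have : ∀ σ : Equiv.Perm (Fin n), ∫⁻ x, f (x ∘ σ) ∂(Measure.pi fun _ : Fin n => μ) =
      ∫⁻ x, f x ∂(Measure.pi fun _ : Fin n => μ) := by
    intro σ
    have e : (Measure.pi fun _ : Fin n => μ).map (fun x => x ∘ σ) =
        Measure.pi fun _ : Fin n => μ := by
      symm
      refine Measure.pi_eq fun s hs => ?_
      rw [Measure.map_apply (hm σ) (MeasurableSet.univ_pi hs)]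
      have : (fun x : Fin n → A => x ∘ σ) ⁻¹' (Set.univ.pi s) =
          Set.univ.pi (fun j => s (σ.symm j)) := by
        ext x
        simp only [Set.mem_preimage, Set.mem_univ_pi, Function.comp]
        constructor
        · intro h j
          simpa using h (σ.symm j)
        · intro h j
          simpa using h (σ j)
      rw [this, Measure.pi_pi]
      exact Equiv.prod_comp σ.symm (fun j => μ (s j))
    conv_rhs => rw [← e]
    rw [lintegral_map hf (hm σ)]
  simp [this]

theorem stmt_10 {A B : Type*} [MeasurableSpace A] [MeasurableSpace B]
    (κ lam : (n : ℕ) → (Fin n → A) → Measure B)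
    (hκm : ∀ n, Measurable (κ n)) (hκ1 : ∀ n x, κ n x Set.univ ≤ 1)
    (hlamm : ∀ n, Measurable (lam n)) (hlam1 : ∀ n x, lam n x Set.univ ≤ 1)
    (F G : Measure A → Measure B)
    (hF : ∀ μ : Measure A,
      F μ = Measure.sum fun n => (Measure.pi fun _ : Fin n => μ).bind (κ n))
    (hG : ∀ μ : Measure A,
      G μ = Measure.sum fun n => (Measure.pi fun _ : Fin n => μ).bind (lam n))
    (hF1 : ∀ μ : Measure A, μ Set.univ ≤ 1 → F μ Set.univ ≤ 1)
    (hG1 : ∀ μ : Measure A, μ Set.univ ≤ 1 → G μ Set.univ ≤ 1)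
    (hfin : ∀ μ : Measure A, IsFinitelySupportedSubProb μ → F μ = G μ) :
    ∀ μ : Measure A, μ Set.univ ≤ 1 → F μ = G μ := by
  classical
  intro μ hμ
  have : IsFiniteMeasure μ := ⟨hμ.trans_lt ENNReal.one_lt_top⟩
  ext U hU
  have app : ∀ (ν : (n : ℕ) → (Fin n → A) → Measure B), (∀ n, Measurable (ν n)) →
      ∀ μ : Measure A, (Measure.sum fun n => (Measure.pi fun _ : Fin n => μ).bind (ν n)) U =
        ∑' n, ∫⁻ x, ν n x U ∂(Measure.pi fun _ : Fin n => μ) := by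
    intro ν hν μ
    rw [Measure.sum_apply _ hU]
    exact tsum_congr fun n => Measure.bind_apply hU (hν n).aemeasurable
  have hmeas : ∀ (ν : (n : ℕ) → (Fin n → A) → Measure B), (∀ n, Measurable (ν n)) →
      ∀ n, Measurable (fun x => ν n x U) := fun ν hν n =>
    (Measure.measurable_coe hU).comp (hν n)
  -- integrals against finitely supported measures
  have fs : ∀ (ν : (n : ℕ) → (Fin n → A) → Measure B), (∀ n, Measurable (ν n)) →
      ∀ (m k : ℕ) (x : Fin k → A) (r : Fin k → ℝ≥0∞), ∑ i, r i ≤ 1 →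
      ∫⁻ y, ν m y U ∂(Measure.pi fun _ : Fin m => ∑ i, r i • Measure.dirac (x i)) =
        ∑ i : Fin m → Fin k, (∏ j, r (i j)) * ν m (x ∘ i) U := by
    intro ν hν m k x r hr
    rw [aux_pi m k x r hr, lintegral_finsetSum_measure]
    refine Finset.sum_congr rfl fun i _ => ?_
    rw [lintegral_smul_measure, lintegral_dirac' _ (hmeas ν hν m), smul_eq_mul]
  -- homogeneous components agree
  have hom : ∀ (m k : ℕ) (x : Fin k → A) (r : Fin k → ℝ≥0∞), ∑ i, r i ≤ 1 →
      ∑ i : Fin m → Fin k, (∏ j, r (i j)) * κ m (x ∘ i) U =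
        ∑ i : Fin m → Fin k, (∏ j, r (i j)) * lam m (x ∘ i) U := by
    intro m k x r hr
    have bd : ∀ (ν : (n : ℕ) → (Fin n → A) → Measure B), (∀ n x, ν n x Set.univ ≤ 1) →
        ∀ m, ∑ i : Fin m → Fin k, (∏ j, r (i j)) * ν m (x ∘ i) U ≤ 1 := by
      intro ν h1 m
      calc ∑ i : Fin m → Fin k, (∏ j, r (i j)) * ν m (x ∘ i) U
          ≤ ∑ i : Fin m → Fin k, (∏ j, r (i j)) := by
            refine Finset.sum_le_sum fun i _ => ?_
            exact mul_le_of_le_one_right' ((measure_mono (Set.subset_univ U)).trans (h1 m _))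
        _ = (∑ i, r i) ^ m := by
            have := Finset.prod_univ_sum (fun _ : Fin m => (Finset.univ : Finset (Fin k)))
              (fun _ i => r i)
            simp only [Fintype.piFinset_univ] at this
            rw [← this]; simp
        _ ≤ 1 := pow_le_one₀ zero_le hr
    refine aux_series_enn (fun m => ∑ i : Fin m → Fin k, (∏ j, r (i j)) * κ m (x ∘ i) U)
      (fun m => ∑ i : Fin m → Fin k, (∏ j, r (i j)) * lam m (x ∘ i) U)
      (bd κ hκ1) (bd lam hlam1) ?_ m
    intro t h0 h1
    have hr' : ∑ i, ENNReal.ofReal t * r i ≤ 1 := by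
      rw [← Finset.mul_sum]
      exact mul_le_one' (by simpa using h1.le) hr
    have e := hfin (∑ i, (ENNReal.ofReal t * r i) • Measure.dirac (x i))
      ⟨k, x, _, hr', rfl⟩
    have e2 := congrArg (fun ν => ν U) e
    simp only [hF, hG] at e2
    rw [app κ hκm, app lam hlamm] at e2
    have rw1 : ∀ (ν : (n : ℕ) → (Fin n → A) → Measure B), (∀ n, Measurable (ν n)) → ∀ m,
        ∫⁻ y, ν m y U ∂(Measure.pi fun _ : Fin m =>
          ∑ i, (ENNReal.ofReal t * r i) • Measure.dirac (x i)) =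
        ENNReal.ofReal t ^ m * ∑ i : Fin m → Fin k, (∏ j, r (i j)) * ν m (x ∘ i) U := by
      intro ν hν m
      rw [fs ν hν m k x _ hr', Finset.mul_sum]
      refine Finset.sum_congr rfl fun i _ => ?_
      rw [Finset.prod_mul_distrib]
      simp [mul_assoc]
    simp only [rw1 κ hκm, rw1 lam hlamm] at e2
    exact e2
  -- symmetrizations agree
  have nt : ∀ (ν : (n : ℕ) → (Fin n → A) → Measure B), (∀ n x, ν n x Set.univ ≤ 1) →
      ∀ n x, ν n x U ≠ ⊤ := fun ν h n x =>
    (((measure_mono (Set.subset_univ U)).trans (h n x)).trans_lt ENNReal.one_lt_top).ne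
  have sym : ∀ (n : ℕ) (x : Fin n → A),
      ∑ σ : Equiv.Perm (Fin n), κ n (x ∘ σ) U = ∑ σ : Equiv.Perm (Fin n), lam n (x ∘ σ) U := by
    intro n x
    have hsub : ∀ S : Finset (Fin n),
        ∑ i ∈ Fintype.piFinset (fun _ : Fin n => S), κ n (x ∘ i) U =
          ∑ i ∈ Fintype.piFinset (fun _ : Fin n => S), lam n (x ∘ i) U := by
      intro S
      set c : ℝ≥0∞ := ((n : ℝ≥0∞) + 1)⁻¹ with hc
      have hc0 : c ≠ 0 := ENNReal.inv_ne_zero.mpr (by finiteness)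
      have hct : c ≠ ⊤ := ENNReal.inv_ne_top.mpr (by simp)
      have hr : ∑ i : Fin n, (if i ∈ S then c else 0) ≤ 1 := by
        calc ∑ i : Fin n, (if i ∈ S then c else 0) ≤ ∑ i : Fin n, c :=
              Finset.sum_le_sum fun i _ => by split_ifs <;> simp
          _ = n * c := by simp
          _ ≤ ((n : ℝ≥0∞) + 1) * c := by gcongr; exact le_self_add
          _ ≤ 1 := ENNReal.mul_inv_le_one _
      have e := hom n n x _ hr
      have rw2 : ∀ g : (Fin n → Fin n) → ℝ≥0∞,
          ∑ i : Fin n → Fin n, (∏ j, (if i j ∈ S then c else 0)) * g i =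
            c ^ n * ∑ i ∈ Fintype.piFinset (fun _ : Fin n => S), g i := by
        intro g
        rw [Finset.mul_sum, ← Finset.sum_subset (Finset.subset_univ
          (Fintype.piFinset (fun _ : Fin n => S)))]
        · refine Finset.sum_congr rfl fun i hi => ?_
          rw [Fintype.mem_piFinset] at hi
          simp [hi]
        · intro i _ hi
          rw [Fintype.mem_piFinset] at hi
          push Not at hi
          obtain ⟨j, hj⟩ := hi
          rw [Finset.prod_eq_zero (Finset.mem_univ j) (by simp [hj]), zero_mul]
      rw [rw2, rw2] at e
      exact (ENNReal.mul_right_inj (pow_ne_zero _ hc0) (ENNReal.pow_ne_top hct)).mp e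
    have cv : ∀ (s : Finset (Fin n → Fin n)),
        ∑ i ∈ s, ((κ n (x ∘ i) U).toReal - (lam n (x ∘ i) U).toReal) =
        (∑ i ∈ s, κ n (x ∘ i) U).toReal - (∑ i ∈ s, lam n (x ∘ i) U).toReal := by
      intro s
      rw [Finset.sum_sub_distrib, ENNReal.toReal_sum fun i _ => nt κ hκ1 n _,
        ENNReal.toReal_sum fun i _ => nt lam hlam1 n _]
    have z := aux_comb n (fun i => (κ n (x ∘ i) U).toReal - (lam n (x ∘ i) U).toReal) (by
      intro S
      rw [cv, hsub S, sub_self])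
    rw [Finset.sum_sub_distrib, ← ENNReal.toReal_sum fun i _ => nt κ hκ1 n _,
        ← ENNReal.toReal_sum fun i _ => nt lam hlam1 n _, sub_eq_zero] at z
    refine (ENNReal.toReal_eq_toReal_iff' ?_ ?_).mp z
    · exact ENNReal.sum_ne_top.mpr fun i _ => nt κ hκ1 n _
    · exact ENNReal.sum_ne_top.mpr fun i _ => nt lam hlam1 n _
  rw [hF, hG, app κ hκm, app lam hlamm]
  refine tsum_congr fun n => ?_
  have e1 := aux_sym n μ (fun x => κ n x U) (hmeas κ hκm n)
  have e2 := aux_sym n μ (fun x => lam n x U) (hmeas lam hlamm n)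
  simp only [sym] at e1
  rw [e1] at e2
  refine (ENNReal.mul_right_inj ?_ ?_).mp e2
  · exact_mod_cast Fintype.card_ne_zero
  · exact ENNReal.natCast_ne_top _
end

section
/- There is no measurable map κ : ℝ → Measure ℝ (with Measure ℝ carrying the Giry σ-algebra) such that for every sub-probability measure μ on ℝ, μ.bind κ = μ.restrict {x : ℝ | μ {x} = 0}, i.e. such that binding along κ computes the continuous (non-atomic) part of every sub-probability measure. -/
open MeasureTheory

theorem stmt_12 :
    ¬ ∃ κ : ℝ → Measure ℝ, Measurable κ ∧
      ∀ μ : Measure ℝ, μ Set.univ ≤ 1 →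
        μ.bind κ = μ.restrict {x : ℝ | μ {x} = 0} := by
  rintro ⟨κ, hκ, h⟩
  have h0 : ∀ a, κ a = 0 := by
    intro a
    have h1 := h (Measure.dirac a) (by simp)
    rw [Measure.dirac_bind hκ] at h1
    have hs : {x : ℝ | Measure.dirac a {x} = 0} = {a}ᶜ := by
      ext x
      by_cases hx : x = a
      · simp [hx]
      · simp [hx, Ne.symm hx]
    rw [h1, hs, Measure.restrict_eq_zero]
    simp
  have h2 := h (volume.restrict (Set.Icc 0 1)) (by simp)
  have hk : κ = fun _ => 0 := funext h0
  have hs : {x : ℝ | (volume.restrict (Set.Icc (0:ℝ) 1)) {x} = 0} = Set.univ := by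
    ext x
    simp
  rw [hs, Measure.restrict_univ] at h2
  have h3 := congrArg (fun m : Measure ℝ => m Set.univ) h2
  simp only [Measure.bind_apply MeasurableSet.univ hκ.aemeasurable, h0] at h3
  simp at h3
end

section
/- There is no family (κₙ)ₙ∈ℕ of sub-probability kernels κₙ from (Fin n → ℝ) to ℝ (measurable maps into Measure ℝ with κₙ(x)(Set.univ) ≤ 1 for all x) such that for every sub-probability measure μ on ℝ, Σₙ ((μ^{⊗n}).bind κₙ) = μ.restrict {x : ℝ | μ {x} = 0}. In other words, the continuous-part map is not given by any power series of sub-probability kernels. -/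
open MeasureTheory

theorem stmt_13 :
    ¬ ∃ κ : (n : ℕ) → (Fin n → ℝ) → Measure ℝ,
      (∀ n, Measurable (κ n)) ∧ (∀ n x, κ n x Set.univ ≤ 1) ∧
      ∀ μ : Measure ℝ, μ Set.univ ≤ 1 →
        (Measure.sum fun n => (Measure.pi fun _ : Fin n => μ).bind (κ n)) =
          μ.restrict {x : ℝ | μ {x} = 0} := by
  rintro ⟨κ, hm, -, h⟩
  have key : ∀ n x, κ n x = 0 := by
    intro n x
    set μ : Measure ℝ := ((n : ENNReal) + 1)⁻¹ • ∑ i, Measure.dirac (x i) with hμ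
    have hc0 : ((n : ENNReal) + 1)⁻¹ ≠ 0 := by simp
    have huniv : μ Set.univ ≤ 1 := by
      simp only [hμ, Measure.smul_apply, Measure.finsetSum_apply, measure_univ, smul_eq_mul,
        Finset.sum_const, Finset.card_univ, Fintype.card_fin, nsmul_eq_mul, mul_one]
      rw [mul_comm, ← div_eq_mul_inv]
      exact ENNReal.div_le_of_le_mul (by simp)
    have hfin : IsFiniteMeasure μ := ⟨lt_of_le_of_lt huniv (by simp)⟩
    have hpos : ∀ i, μ {x i} ≠ 0 := by
      intro i
      simp only [hμ, Measure.smul_apply, Measure.finsetSum_apply, smul_eq_mul]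
      refine mul_ne_zero hc0 fun h0 => ?_
      have := (Finset.sum_eq_zero_iff.1 h0) i (Finset.mem_univ i)
      simp at this
    have hrange : μ (Set.range x)ᶜ = 0 := by
      simp [hμ, Measure.smul_apply, Measure.finsetSum_apply,
        Measure.dirac_apply' _ (Set.finite_range x).measurableSet.compl]
    have hS : μ {y : ℝ | μ {y} = 0} = 0 := by
      refine measure_mono_null ?_ hrange
      rintro y hy ⟨i, rfl⟩
      exact hpos i hy
    have hz := h μ huniv
    rw [Measure.restrict_eq_zero.2 hS, Measure.sum_eq_zero] at hz
    have hb := congrArg (fun ν : Measure ℝ => ν Set.univ) (hz n)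
    simp only [Measure.coe_zero, Pi.zero_apply] at hb
    rw [Measure.bind_apply MeasurableSet.univ (hm n).aemeasurable] at hb
    have hmeas : Measurable fun a => κ n a Set.univ :=
      (Measure.measurable_coe MeasurableSet.univ).comp (hm n)
    rw [lintegral_eq_zero_iff hmeas] at hb
    by_contra hx
    have h1 : (Measure.pi fun _ : Fin n => μ) {x} = 0 := by
      refine measure_mono_null ?_ (ae_iff.1 hb)
      rintro y rfl
      simpa using hx
    rw [Measure.pi_singleton, Finset.prod_eq_zero_iff] at h1
    obtain ⟨i, -, hi⟩ := h1
    exact hpos i hi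
  have hv := h (volume.restrict (Set.Icc (0:ℝ) 1)) (by simp)
  have hk : ∀ n, κ n = 0 := fun n => funext (key n)
  have h0 := congrArg (fun ν : Measure ℝ => ν Set.univ) hv
  simp [hk] at h0
end

section
/- Let A be a measurable space. For each n ∈ ℕ let κₙ be a sub-probability kernel from (Fin n → A) to A, and define F(μ) = Σₙ ((μ^{⊗n}).bind κₙ) for sub-probability measures μ on A; assume F(μ)(Set.univ) ≤ 1 whenever μ(Set.univ) ≤ 1. Then: (i) the sequence of iterates F^[k](0) (starting from the zero measure) is monotone increasing in the pointwise order on measures; (ii) there is a sub-probability measure μ* on A with μ*(E) = ⨆ₖ (F^[k](0))(E) for every measurable set E; (iii) F(μ*) = μ*; and (iv) μ* ≤ ν for every sub-probability measure ν with F(ν) = ν, i.e. μ* is the least fixed point of F and equals sup_k F^k(0). -/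
open MeasureTheory

theorem aux_tsum_iSup (f : ℕ → ℕ → ENNReal) (hf : Monotone f) :
    ∑' i, ⨆ k, f k i = ⨆ k, ∑' i, f k i := by
  have h := lintegral_iSup (μ := Measure.count) (f := f) (fun n => measurable_of_countable _) hf
  simpa [lintegral_count] using h

theorem aux_exists_sup {X : Type*} [MeasurableSpace X] (m : ℕ → Measure X) (hm : Monotone m) :
    ∃ μ : Measure X, ∀ E, MeasurableSet E → μ E = ⨆ k, m k E := by
  refine ⟨Measure.ofMeasurable (fun E _ => ⨆ k, m k E) (by simp) ?_, ?_⟩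
  · intro f hf hd
    rw [aux_tsum_iSup (fun k i => m k (f i)) (fun a b hab i => hm hab _)]
    simp only [measure_iUnion hd hf]
  · intro E hE
    rw [Measure.ofMeasurable_apply _ hE]

theorem aux_lintegral_sup {X : Type*} [MeasurableSpace X] (m : ℕ → Measure X) (hm : Monotone m)
    (μ : Measure X) (hμ : ∀ E, MeasurableSet E → μ E = ⨆ k, m k E)
    (f : X → ENNReal) (hf : Measurable f) :
    ∫⁻ x, f x ∂μ = ⨆ k, ∫⁻ x, f x ∂(m k) := by
  simp_rw [lintegral_eq_iSup_eapprox_lintegral hf]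
  rw [iSup_comm]
  congr 1
  ext n : 1
  simp only [SimpleFunc.lintegral]
  rw [← ENNReal.finsetSum_iSup_of_monotone]
  · refine Finset.sum_congr rfl fun x _ => ?_
    rw [hμ _ (SimpleFunc.measurableSet_preimage _ _), ENNReal.mul_iSup]
  · intro x a b hab
    exact mul_le_mul_right (hm hab _) _

theorem aux_pi_mono {A : Type*} [MeasurableSpace A] (n : ℕ) (μ ν : Measure A)
    [IsFiniteMeasure μ] [IsFiniteMeasure ν] (h : μ ≤ ν) :
    (Measure.pi fun _ : Fin n => μ) ≤ Measure.pi fun _ : Fin n => ν := by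
  have h1 : (Measure.pi fun _ : Fin n => μ).toOuterMeasure ≤
      OuterMeasure.pi fun _ : Fin n => ν.toOuterMeasure := by
    rw [OuterMeasure.le_pi]
    intro s _
    have := Measure.pi_pi (fun _ : Fin n => μ) s
    refine this.le.trans ?_
    exact Finset.prod_le_prod' fun i _ => h _
  refine Measure.le_iff.2 fun s hs => ?_
  rw [Measure.pi_def (fun _ : Fin n => ν), toMeasure_apply _ _ hs]
  exact h1 s

theorem aux_pi_sup {A : Type*} [MeasurableSpace A] (n : ℕ) (m : ℕ → Measure A) (hm : Monotone m)
    [∀ k, IsFiniteMeasure (m k)]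
    (μ : Measure A) [IsFiniteMeasure μ] (hμ : ∀ E, MeasurableSet E → μ E = ⨆ k, m k E) :
    ∀ E, MeasurableSet E → (Measure.pi fun _ : Fin n => μ) E =
      ⨆ k, (Measure.pi fun _ : Fin n => m k) E := by
  have hmono : Monotone fun k => Measure.pi fun _ : Fin n => m k :=
    fun a b hab => aux_pi_mono n _ _ (hm hab)
  obtain ⟨ρ, hρ⟩ := aux_exists_sup _ hmono
  have : (Measure.pi fun _ : Fin n => μ) = ρ := by
    refine Measure.pi_eq fun s hs => ?_
    rw [hρ _ (MeasurableSet.univ_pi hs)]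
    have h1 := tendsto_atTop_iSup
      (f := fun k => (Measure.pi fun _ : Fin n => m k) (Set.univ.pi s))
      (fun a b hab => hmono hab _)
    refine tendsto_nhds_unique h1 ?_
    simp only [Measure.pi_pi]
    refine ENNReal.tendsto_finsetProd_of_ne_top _ (fun i _ => ?_) fun i _ => measure_ne_top _ _
    rw [hμ _ (hs i)]
    exact tendsto_atTop_iSup fun a b hab => hm hab _
  rw [this]
  exact hρ

theorem stmt_14 {A : Type*} [MeasurableSpace A]
    (κ : (n : ℕ) → (Fin n → A) → Measure A)
    (hκm : ∀ n, Measurable (κ n)) (hκ1 : ∀ n x, κ n x Set.univ ≤ 1)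
    (F : Measure A → Measure A)
    (hF : ∀ μ : Measure A,
      F μ = Measure.sum fun n => (Measure.pi fun _ : Fin n => μ).bind (κ n))
    (hF1 : ∀ μ : Measure A, μ Set.univ ≤ 1 → F μ Set.univ ≤ 1) :
    (Monotone fun k : ℕ => F^[k] 0) ∧
    ∃ μstar : Measure A, μstar Set.univ ≤ 1 ∧
      (∀ E : Set A, MeasurableSet E → μstar E = ⨆ k : ℕ, (F^[k] 0) E) ∧
      F μstar = μstar ∧
      ∀ ν : Measure A, ν Set.univ ≤ 1 → F ν = ν → μstar ≤ ν := by
  have hfin : ∀ μ : Measure A, μ Set.univ ≤ 1 → IsFiniteMeasure μ := fun μ h =>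
    ⟨h.trans_lt ENNReal.one_lt_top⟩
  have hFE : ∀ (μ : Measure A) (E : Set A), MeasurableSet E →
      F μ E = ∑' n, ∫⁻ x, κ n x E ∂(Measure.pi fun _ : Fin n => μ) := by
    intro μ E hE
    rw [hF, Measure.sum_apply _ hE]
    exact tsum_congr fun n => Measure.bind_apply hE (hκm n).aemeasurable
  have hFmono : ∀ μ ν : Measure A, μ Set.univ ≤ 1 → ν Set.univ ≤ 1 → μ ≤ ν → F μ ≤ F ν := by
    intro μ ν h1 h2 h
    have := hfin μ h1
    have := hfin ν h2
    refine Measure.le_iff.2 fun E hE => ?_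
    rw [hFE _ _ hE, hFE _ _ hE]
    exact ENNReal.tsum_le_tsum fun n => lintegral_mono' (aux_pi_mono n _ _ h) le_rfl
  have hs : ∀ k, (F^[k] 0) Set.univ ≤ 1 := by
    intro k
    induction k with
    | zero => simp
    | succ k ih => rw [Function.iterate_succ_apply']; exact hF1 _ ih
  have hmono : Monotone fun k : ℕ => F^[k] 0 := by
    refine monotone_nat_of_le_succ fun k => ?_
    induction k with
    | zero => exact Measure.zero_le _
    | succ k ih =>
      have := hFmono _ _ (hs k) (hs (k + 1)) ih
      rwa [← Function.iterate_succ_apply' F, ← Function.iterate_succ_apply' F] at this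
  refine ⟨hmono, ?_⟩
  obtain ⟨μ, hμ⟩ := aux_exists_sup _ hmono
  have hμ1 : μ Set.univ ≤ 1 := by
    rw [hμ _ MeasurableSet.univ]
    exact iSup_le hs
  have := hfin μ hμ1
  have := fun k => hfin _ (hs k)
  refine ⟨μ, hμ1, hμ, ?_, ?_⟩
  · ext E hE
    have hpm : ∀ n, Monotone fun k => Measure.pi fun _ : Fin n => F^[k] 0 :=
      fun n a b hab => aux_pi_mono n _ _ (hmono hab)
    have h1 : F μ E = ⨆ k, F (F^[k] 0) E := by
      simp only [hFE _ _ hE]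
      rw [← aux_tsum_iSup (fun k n => ∫⁻ x, κ n x E ∂(Measure.pi fun _ : Fin n => F^[k] 0))
        (fun a b hab n => lintegral_mono' (hpm n hab) le_rfl)]
      exact tsum_congr fun n => aux_lintegral_sup _ (hpm n) _ (aux_pi_sup n _ hmono μ hμ) _
        ((Measure.measurable_coe hE).comp (hκm n))
    rw [h1, hμ _ hE]
    simp only [← Function.iterate_succ_apply' F]
    exact Monotone.iSup_nat_add (f := fun k => (F^[k] 0) E) (fun a b hab => hmono hab E) 1
  · intro ν hν hfix
    have hle : ∀ k, F^[k] 0 ≤ ν := by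
      intro k
      induction k with
      | zero => exact Measure.zero_le _
      | succ k ih =>
        rw [Function.iterate_succ_apply', ← hfix]
        exact hFmono _ _ (hs k) hν ih
    refine Measure.le_iff.2 fun E hE => ?_
    rw [hμ _ hE]
    exact iSup_le fun k => hle k E
end
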